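/- arXiv:2010.10689 — 2 statements merged into one kernel-verified Lean document; each statement's English description precedes it below -/
import Mathlib

section
/- For every real number k > 0 and every positive integer n, the series ∑_{q≥1} c_q(n)/q^{k+1} converges absolutely and satisfies n^k · ζ(k+1) · ∑_{q≥1} c_q(n)/q^{k+1} = σ_k(n). -/
open Finset

/-- The real-variable Ramanujan sum `c_q(x) = ∑_{1 ≤ k ≤ q, gcd(k,q)=1} e^{2πikx/q}`. -/
noncomputable def cq (q : ℕ) (x : ℝ) : ℂ :=
  ∑ k ∈ (Finset.Icc 1 q).filter (fun k => Nat.gcd k q = 1),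
    Complex.exp (2 * (Real.pi : ℂ) * Complex.I * (k : ℂ) * (x : ℂ) / (q : ℂ))

/-- The Riemann zeta function of a real argument `s > 1`, as the series `∑_{n≥1} n^{-s}`. -/
noncomputable def zetaR (s : ℝ) : ℝ := ∑' n : ℕ, 1 / (n + 1 : ℝ) ^ s

/-- Summing `c_d(x)` over the divisors `d` of `q` removes the coprimality condition. -/
theorem sum_divisors_cq (q : ℕ) (hq : q ≠ 0) (x : ℝ) :
    ∑ d ∈ q.divisors, cq d x =
      ∑ j ∈ Finset.Icc 1 q, Complex.exp (2 * (Real.pi : ℂ) * Complex.I * j * x / q) := by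
  unfold cq
  rw [Finset.sum_sigma']
  refine Finset.sum_bij' (fun p _ => p.2 * (q / p.1))
    (fun j _ => ⟨q / Nat.gcd j q, j / Nat.gcd j q⟩) ?_ ?_ ?_ ?_ ?_
  · rintro ⟨d, k⟩ h
    simp only [Finset.mem_sigma, Nat.mem_divisors, Finset.mem_filter, Finset.mem_Icc] at h ⊢
    obtain ⟨⟨⟨e, rfl⟩, -⟩, ⟨h1, h2⟩, -⟩ := h
    have hd : 0 < d := h1.trans h2
    have he : 0 < e := Nat.pos_of_ne_zero (right_ne_zero_of_mul hq)
    rw [Nat.mul_div_cancel_left _ hd]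
    exact ⟨Nat.mul_pos h1 he, Nat.mul_le_mul_right _ h2⟩
  · intro j h
    simp only [Finset.mem_sigma, Nat.mem_divisors, Finset.mem_filter, Finset.mem_Icc] at h ⊢
    have hg : 0 < Nat.gcd j q := Nat.gcd_pos_of_pos_left _ h.1
    exact ⟨⟨Nat.div_dvd_of_dvd (Nat.gcd_dvd_right _ _), hq⟩,
      ⟨Nat.div_pos (Nat.gcd_le_left _ h.1) hg, Nat.div_le_div_right h.2⟩,
      Nat.coprime_div_gcd_div_gcd hg⟩
  · rintro ⟨d, k⟩ h
    simp only [Finset.mem_sigma, Nat.mem_divisors, Finset.mem_filter, Finset.mem_Icc] at h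
    obtain ⟨⟨⟨e, rfl⟩, -⟩, ⟨h1, h2⟩, h3⟩ := h
    have hd : 0 < d := h1.trans h2
    have he : 0 < e := Nat.pos_of_ne_zero (right_ne_zero_of_mul hq)
    simp [Nat.mul_div_cancel_left _ hd, Nat.gcd_mul_right, h3, Nat.mul_div_cancel _ he]
  · intro j h
    simp only [Finset.mem_Icc] at h
    dsimp only
    rw [Nat.div_div_self (Nat.gcd_dvd_right _ _) hq, Nat.div_mul_cancel (Nat.gcd_dvd_left _ _)]
  · rintro ⟨d, k⟩ h
    simp only [Finset.mem_sigma, Nat.mem_divisors, Finset.mem_filter, Finset.mem_Icc] at h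
    obtain ⟨⟨⟨e, rfl⟩, -⟩, ⟨h1, h2⟩, -⟩ := h
    have hd : 0 < d := h1.trans h2
    have he : 0 < e := Nat.pos_of_ne_zero (right_ne_zero_of_mul hq)
    have hd' : (d : ℂ) ≠ 0 := by exact_mod_cast hd.ne'
    have he' : (e : ℂ) ≠ 0 := by exact_mod_cast he.ne'
    dsimp only
    rw [Nat.mul_div_cancel_left _ hd]
    congr 1
    push_cast
    field_simp

theorem sum_exp_mul_div (q : ℕ) (hq : q ≠ 0) (n : ℕ) :
    ∑ j ∈ Finset.Icc 1 q,
        Complex.exp (2 * (Real.pi : ℂ) * Complex.I * j * ((n : ℝ) : ℂ) / q) =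
      if q ∣ n then (q : ℂ) else 0 := by
  have hq' : (q : ℂ) ≠ 0 := by exact_mod_cast hq
  set ω := Complex.exp (2 * (Real.pi : ℂ) * Complex.I / q) with hω_def
  have hω : IsPrimitiveRoot ω q := Complex.isPrimitiveRoot_exp q hq
  have hterm (j : ℕ) :
      Complex.exp (2 * (Real.pi : ℂ) * Complex.I * j * ((n : ℝ) : ℂ) / q) = (ω ^ n) ^ j := by
    rw [hω_def, ← Complex.exp_nat_mul, ← Complex.exp_nat_mul]
    congr 1
    push_cast
    ring
  simp only [hterm]
  split_ifs with h
  · simp [hω.pow_eq_one_iff_dvd n |>.2 h]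
  · have h1 : ω ^ n ≠ 1 := fun h' => h ((hω.pow_eq_one_iff_dvd n).1 h')
    have hpow : (ω ^ n) ^ q = 1 := by rw [← pow_mul, mul_comm, pow_mul, hω.pow_eq_one, one_pow]
    rw [← Finset.Ico_add_one_right_eq_Icc, geom_sum_Ico h1 (by lia), pow_succ, hpow]
    simp

/-- The function `q ↦ c_q(n)` as an arithmetic function. -/
noncomputable def ramanujanSum (n : ℕ) : ArithmeticFunction ℂ :=
  ⟨fun q => cq q (n : ℝ), by simp [cq]⟩

/-- The function `q ↦ q` on the divisors of `n`, extended by zero. -/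
noncomputable def idOnDivisors (n : ℕ) : ArithmeticFunction ℂ :=
  ⟨fun q => if q ∣ n then (q : ℂ) else 0, by simp⟩

open ArithmeticFunction ArithmeticFunction.zeta in
theorem ramanujanSum_mul_zeta (n : ℕ) :
    ramanujanSum n * (ζ : ArithmeticFunction ℂ) = idOnDivisors n := by
  ext q
  rcases eq_or_ne q 0 with rfl | hq
  · simp
  · rw [coe_mul_zeta_apply]
    exact (sum_divisors_cq q hq n).trans (sum_exp_mul_div q hq n)

open ArithmeticFunction ArithmeticFunction.zeta ArithmeticFunction.Moebius in
theorem ramanujanSum_eq (n : ℕ) :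
    ramanujanSum n = idOnDivisors n * (μ : ArithmeticFunction ℂ) := by
  rw [← ramanujanSum_mul_zeta, mul_assoc, coe_zeta_mul_coe_moebius, mul_one]

theorem LSeriesHasSum_idOnDivisors (n : ℕ) (hn : n ≠ 0) (s : ℂ) :
    LSeriesHasSum (idOnDivisors n) s (∑ d ∈ n.divisors, (d : ℂ) / (d : ℂ) ^ s) := by
  have h : ∑ d ∈ n.divisors, (d : ℂ) / (d : ℂ) ^ s =
      ∑ d ∈ n.divisors, LSeries.term (idOnDivisors n) s d := by
    refine Finset.sum_congr rfl fun d hd => ?_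
    rw [LSeries.term_of_ne_zero (Nat.pos_of_mem_divisors hd).ne']
    simp [idOnDivisors, Nat.dvd_of_mem_divisors hd]
  rw [h]
  refine hasSum_sum_of_ne_finset_zero fun d hd => ?_
  have hd' : ¬ d ∣ n := fun h' => hd (Nat.mem_divisors.2 ⟨h', hn⟩)
  rcases eq_or_ne d 0 with rfl | h0
  · simp
  · simp [LSeries.term_of_ne_zero h0, idOnDivisors, hd']

open ArithmeticFunction ArithmeticFunction.Moebius in
theorem LSeriesSummable_ramanujanSum (n : ℕ) (hn : n ≠ 0) {s : ℂ} (hs : 1 < s.re) :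
    LSeriesSummable (ramanujanSum n) s := by
  have hμ : LSeriesSummable (μ : ArithmeticFunction ℂ) s :=
    (LSeriesSummable_congr s fun _ => intCoe_apply).2 (LSeriesSummable_moebius_iff.2 hs)
  rw [ramanujanSum_eq]
  exact LSeriesSummable_mul (LSeriesHasSum_idOnDivisors n hn s).LSeriesSummable hμ

open ArithmeticFunction ArithmeticFunction.zeta in
theorem LSeriesHasSum_coe_zeta {s : ℂ} (hs : 1 < s.re) :
    LSeriesHasSum (ζ : ArithmeticFunction ℂ) s (riemannZeta s) :=
  (LSeriesHasSum_congr s _ fun _ => natCoe_apply).2 (LSeriesHasSum_zeta hs)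

theorem ofReal_zetaR (s : ℝ) (hs : 1 < s) : (zetaR s : ℂ) = riemannZeta s := by
  rw [zeta_eq_tsum_one_div_nat_add_one_cpow (by simpa using hs), zetaR, Complex.ofReal_tsum]
  refine tsum_congr fun m => ?_
  rw [Complex.ofReal_div, Complex.ofReal_cpow (by positivity)]
  simp

theorem rpow_mul_sum_divisors_div (k : ℝ) (n : ℕ) :
    (n : ℝ) ^ k * ∑ d ∈ n.divisors, (d : ℝ) / (d : ℝ) ^ (k + 1) =
      ∑ d ∈ n.divisors, (d : ℝ) ^ k := by
  rw [Finset.mul_sum, ← Nat.sum_div_divisors n fun d => (d : ℝ) ^ k]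
  refine Finset.sum_congr rfl fun d hd => ?_
  have hd0 : (0 : ℝ) < d := by exact_mod_cast Nat.pos_of_mem_divisors hd
  rw [Nat.cast_div (Nat.dvd_of_mem_divisors hd) hd0.ne', Real.div_rpow (by positivity) hd0.le,
    Real.rpow_add_one hd0.ne']
  field_simp

/-- For every real `k > 0` and every positive integer `n`, the series `∑_{q≥1} c_q(n)/q^{k+1}`
converges absolutely and `n^k·ζ(k+1)·∑_{q≥1} c_q(n)/q^{k+1} = σ_k(n)`. -/
theorem stmt4 (k : ℝ) (hk : 0 < k) (n : ℕ) (hn : 0 < n) :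
    Summable (fun q : ℕ => ‖cq q (n : ℝ) / (q : ℂ) ^ ((k : ℂ) + 1)‖) ∧
    (((n : ℝ) ^ k * zetaR (k + 1) : ℝ) : ℂ) *
        ∑' q : ℕ, cq q (n : ℝ) / (q : ℂ) ^ ((k : ℂ) + 1)
      = ((∑ d ∈ n.divisors, (d : ℝ) ^ k : ℝ) : ℂ) := by
  have hs : 1 < ((k : ℂ) + 1).re := by simpa using hk
  have hterm : LSeries.term (ramanujanSum n) ((k : ℂ) + 1) =
      fun q : ℕ => cq q (n : ℝ) / (q : ℂ) ^ ((k : ℂ) + 1) := by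
    funext q
    rcases eq_or_ne q 0 with rfl | hq
    · simp [cq]
    · rw [LSeries.term_of_ne_zero hq]
      rfl
  have hid := LSeriesHasSum_idOnDivisors n hn.ne' ((k : ℂ) + 1)
  have hsum := LSeriesSummable_ramanujanSum n hn.ne' hs
  have hprod := ArithmeticFunction.LSeriesHasSum_mul hsum.LSeriesHasSum
    (LSeriesHasSum_coe_zeta hs)
  rw [ramanujanSum_mul_zeta] at hprod
  have key := hprod.LSeries_eq.symm.trans hid.LSeries_eq
  rw [LSeries, hterm] at key
  rw [LSeriesSummable, hterm] at hsum
  refine ⟨hsum.norm, ?_⟩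
  have hcast : ∑ d ∈ n.divisors, (d : ℂ) / (d : ℂ) ^ ((k : ℂ) + 1) =
      ((∑ d ∈ n.divisors, (d : ℝ) / (d : ℝ) ^ (k + 1) : ℝ) : ℂ) := by
    rw [Complex.ofReal_sum]
    refine Finset.sum_congr rfl fun d _ => ?_
    rw [Complex.ofReal_div, Complex.ofReal_cpow (by positivity)]
    simp
  have hz := ofReal_zetaR (k + 1) (by linarith)
  rw [Complex.ofReal_add, Complex.ofReal_one] at hz
  rw [← rpow_mul_sum_divisors_div, Complex.ofReal_mul, Complex.ofReal_mul, hz, ← hcast, ← key]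
  ring
end

section
/- For every real number x that is not an integer, the series −∑_{q≥1} (log q / q) · c_q(x) does not converge (its sequence of partial sums has no limit). -/
open Finset

/-- The geometric sum behind the Ramanujan sum of prime index. -/
theorem cq_prime_mul {p : ℕ} (hp : p.Prime) (x : ℝ) :
    cq p x * (Complex.exp (Complex.I * ((2 * Real.pi * x / p : ℝ) : ℂ)) - 1) =
      Complex.exp (2 * (Real.pi : ℂ) * Complex.I * (x : ℂ)) -
        Complex.exp (Complex.I * ((2 * Real.pi * x / p : ℝ) : ℂ)) := by
  have hp0 : (p : ℂ) ≠ 0 := by exact_mod_cast hp.ne_zero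
  have hfilter : (Finset.Icc 1 p).filter (fun k => Nat.gcd k p = 1) = Finset.Ico 1 p := by
    ext k
    simp only [Finset.mem_filter, Finset.mem_Icc, Finset.mem_Ico]
    constructor
    · rintro ⟨⟨h1, h2⟩, h3⟩
      refine ⟨h1, lt_of_le_of_ne h2 ?_⟩
      rintro rfl
      rw [Nat.gcd_self] at h3
      exact hp.one_lt.ne' h3
    · rintro ⟨h1, h2⟩
      exact ⟨⟨h1, h2.le⟩, (Nat.coprime_of_lt_prime (by omega) h2 hp).symm⟩
  have hpow : Complex.exp (2 * (Real.pi : ℂ) * Complex.I * (x : ℂ)) =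
      Complex.exp (Complex.I * ((2 * Real.pi * x / p : ℝ) : ℂ)) ^ p := by
    rw [← Complex.exp_nat_mul]
    congr 1
    push_cast
    field_simp
  have hsum : cq p x =
      ∑ k ∈ Finset.Ico 1 p, Complex.exp (Complex.I * ((2 * Real.pi * x / p : ℝ) : ℂ)) ^ k := by
    rw [cq, hfilter]
    refine Finset.sum_congr rfl fun k _ => ?_
    rw [← Complex.exp_nat_mul]
    congr 1
    push_cast
    field_simp
  rw [hsum, hpow, geom_sum_Ico_mul _ hp.one_lt.le, pow_one]

/-- For prime `p`, the `p`-th term of the series is large unless `exp (2πix) = 1`. -/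
theorem norm_exp_sub_one_mul_log_le {p : ℕ} (hp : p.Prime) (x : ℝ) :
    ‖Complex.exp (2 * (Real.pi : ℂ) * Complex.I * (x : ℂ)) - 1‖ * Real.log p ≤
      |2 * Real.pi * x| * (‖((Real.log p / p : ℝ) : ℂ) * cq p x‖ + 1) := by
  have hp0 : (0 : ℝ) < p := by exact_mod_cast hp.pos
  have hlog : 0 ≤ Real.log p := Real.log_natCast_nonneg p
  have hloglt : Real.log p ≤ p := Real.log_le_self hp0.le
  have hmul := congrArg norm (cq_prime_mul hp x)
  have hw := Real.norm_exp_I_mul_ofReal_sub_one_le (x := 2 * Real.pi * x / p)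
  rw [Real.norm_eq_abs, abs_div, abs_of_pos hp0] at hw
  set e := Complex.exp (2 * (Real.pi : ℂ) * Complex.I * (x : ℂ))
  set w := Complex.exp (Complex.I * ((2 * Real.pi * x / p : ℝ) : ℂ))
  set C := |2 * Real.pi * x|
  rw [norm_mul] at hmul
  have htri : ‖e - 1‖ ≤ (‖cq p x‖ + 1) * (C / p) := by
    calc ‖e - 1‖ ≤ ‖e - w‖ + ‖w - 1‖ := norm_sub_le_norm_sub_add_norm_sub _ _ _
      _ = (‖cq p x‖ + 1) * ‖w - 1‖ := by rw [← hmul]; ring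
      _ ≤ _ := by gcongr
  have hterm : ‖((Real.log p / p : ℝ) : ℂ) * cq p x‖ = Real.log p / p * ‖cq p x‖ := by
    rw [norm_mul, Complex.norm_real, Real.norm_of_nonneg (by positivity)]
  have hC : 0 ≤ C := abs_nonneg _
  calc ‖e - 1‖ * Real.log p ≤ (‖cq p x‖ + 1) * (C / p) * Real.log p := by gcongr
    _ = C * (Real.log p / p * ‖cq p x‖ + Real.log p / p) := by ring
    _ ≤ C * (‖((Real.log p / p : ℝ) : ℂ) * cq p x‖ + 1) := by
      rw [hterm]
      gcongr
      exact (div_le_one hp0).2 hloglt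

/-- For every real `x ∉ ℤ`, the series `−∑_{q≥1} (log q / q)·c_q(x)` does not converge
(its sequence of partial sums has no limit). -/
theorem stmt7 (x : ℝ) (hx : ∀ n : ℤ, x ≠ n) :
    ¬ ∃ L : ℂ, Filter.Tendsto
      (fun Q : ℕ => -∑ q ∈ Finset.Icc 1 Q, ((Real.log q / q : ℝ) : ℂ) * cq q x)
      Filter.atTop (nhds L) := by
  rintro ⟨L, hL⟩
  have hterm : Filter.Tendsto
      (fun q : ℕ => ((Real.log (q + 1 : ℕ) / (q + 1 : ℕ) : ℝ) : ℂ) * cq (q + 1) x)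
      Filter.atTop (nhds 0) := by
    have h := hL.sub ((Filter.tendsto_add_atTop_iff_nat 1).2 hL)
    rw [sub_self] at h
    refine h.congr fun q => ?_
    rw [Finset.sum_Icc_succ_top (by omega)]
    ring
  have hδ : 0 < ‖Complex.exp (2 * (Real.pi : ℂ) * Complex.I * (x : ℂ)) - 1‖ := by
    rw [norm_pos_iff, sub_ne_zero]
    intro h
    obtain ⟨n, hn⟩ := Complex.exp_eq_one_iff.1 h
    refine hx n ?_
    have h2 : (x : ℂ) = n :=
      mul_left_cancel₀ Complex.two_pi_I_ne_zero (by rw [hn]; ring)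
    exact_mod_cast h2
  have hlog : Filter.Tendsto (fun q : ℕ =>
      ‖Complex.exp (2 * (Real.pi : ℂ) * Complex.I * (x : ℂ)) - 1‖ * Real.log (q + 1 : ℕ))
      Filter.atTop Filter.atTop :=
    (Real.tendsto_log_atTop.comp (tendsto_natCast_atTop_atTop.comp
      (Filter.tendsto_add_atTop_nat 1))).const_mul_atTop hδ
  have hnorm := hterm.norm
  rw [norm_zero] at hnorm
  obtain ⟨N, hN⟩ := Filter.eventually_atTop.1
    ((hnorm.eventually_le_const one_pos).and
      (hlog.eventually_gt_atTop (|2 * Real.pi * x| * (1 + 1))))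
  obtain ⟨p, hpN, hp⟩ := Nat.exists_infinite_primes (N + 1)
  obtain ⟨q, rfl⟩ : ∃ q, p = q + 1 := ⟨p - 1, by omega⟩
  obtain ⟨h1, h2⟩ := hN q (by omega)
  refine absurd (norm_exp_sub_one_mul_log_le hp x) (not_le.2 (lt_of_le_of_lt ?_ h2))
  gcongr
end
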